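/- For each n, let Δ_n be a measurable ℕ-valued random variable on a probability space (Ω_n, P_n), let ε_n ∈ (0,1), let C_n ≥ 1 be a natural number, and let δ_n ∈ [0,1). Assume: (a) ε_n · C_n → 0 as n → ∞; (b) E[Δ_n · 1_{Δ_n ≤ C_n}] → 0; (c) C_n · P_n(Δ_n > C_n) → 0; (d) for all naturals i ≥ 0 and 0 ≤ j ≤ C_n − 1, P_n(Δ_n > C_n + i·C_n + j) ≤ P_n(Δ_n > C_n) · δ_n^{i}; (e) δ_n → 0. Then for all sufficiently large n the expectation E[(1−ε_n)^{−Δ_n}] is finite, and ( E[(1−ε_n)^{−Δ_n}] − 1 ) / ε_n → 0 as n → ∞. -/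

import Mathlib

open MeasureTheory Filter

/-- If `ε c ≤ 1/2`, then `(1 - ε)^{-c} ≤ 2`. -/
lemma inv_one_sub_pow_le_two {ε : ℝ} (hε1 : ε < 1) {c : ℕ} (hεc : ε * c ≤ 1 / 2) :
    ((1 - ε)⁻¹) ^ c ≤ 2 := by
  have bernoulli := one_add_mul_le_pow (a := -ε) (by linarith) c
  have half_le : 1 / 2 ≤ (1 - ε) ^ c := by
    rw [← sub_eq_add_neg] at bernoulli
    linarith
  rw [inv_pow]
  exact inv_le_of_inv_le₀ (by norm_num) (by linarith)

lemma inv_one_sub_pow_sub_one_le {ε : ℝ} (hε1 : ε < 1) (m : ℕ) :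
    ((1 - ε)⁻¹) ^ m - 1 ≤ m * ε * ((1 - ε)⁻¹) ^ m := by
  have bernoulli : 1 - m * ε ≤ (1 - ε) ^ m := by
    have := one_add_mul_le_pow (a := -ε) (by linarith) m
    rw [← sub_eq_add_neg] at this
    linarith
  have pos : 0 < (1 - ε) ^ m := pow_pos (by linarith) m
  rw [inv_pow]
  have := mul_le_mul_of_nonneg_right bernoulli (inv_nonneg.2 pos.le)
  rw [mul_inv_cancel₀ pos.ne'] at this
  linarith

/-- For `m` in the block `(c + i c, c + (i + 1) c]`, the exponential `(1 - ε)^{-m}` exceeds `1`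
by at most `8 c ε 4 ^ i`. -/
lemma inv_one_sub_pow_sub_one_le_block {ε : ℝ} (hε0 : 0 < ε) (hε1 : ε < 1) {c : ℕ}
    (hεc : ε * c ≤ 1 / 2) {m i : ℕ} (hm : m ≤ (i + 2) * c) :
    ((1 - ε)⁻¹) ^ m - 1 ≤ 8 * c * ε * 4 ^ i := by
  have one_le : 1 ≤ (1 - ε)⁻¹ := (one_le_inv₀ (by linarith)).2 (by linarith)
  have pow_le : ((1 - ε)⁻¹) ^ m ≤ 2 ^ (i + 2) := calc
    ((1 - ε)⁻¹) ^ m ≤ ((1 - ε)⁻¹) ^ (c * (i + 2)) :=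
      pow_le_pow_right₀ one_le (by linarith)
    _ = (((1 - ε)⁻¹) ^ c) ^ (i + 2) := pow_mul _ _ _
    _ ≤ 2 ^ (i + 2) :=
      pow_le_pow_left₀ (by positivity) (inv_one_sub_pow_le_two hε1 hεc) _
  have linear_le : ((i + 2 : ℕ) : ℝ) ≤ 2 ^ (i + 1) := by
    exact_mod_cast Nat.lt_two_pow_self (n := i + 1)
  have m_le : (m : ℝ) ≤ ((i + 2 : ℕ) : ℝ) * c := by exact_mod_cast hm
  calc ((1 - ε)⁻¹) ^ m - 1 ≤ m * ε * ((1 - ε)⁻¹) ^ m := inv_one_sub_pow_sub_one_le hε1 m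
    _ ≤ (2 ^ (i + 1) * c) * ε * 2 ^ (i + 2) := by
      gcongr
      exact m_le.trans (by gcongr)
    _ = 8 * c * ε * 4 ^ i := by
      rw [show (4 : ℝ) = 2 * 2 by norm_num, mul_pow]
      ring

lemma ofReal_inv_one_sub_pow_sub_one_le {ε : ℝ} (hε0 : 0 < ε) (hε1 : ε < 1) {c : ℕ}
    (hc : 1 ≤ c) (hεc : ε * c ≤ 1 / 2) (m : ℕ) :
    ENNReal.ofReal (((1 - ε)⁻¹) ^ m - 1) ≤
      ENNReal.ofReal (2 * ε * (if m ≤ c then (m : ℝ) else 0)) +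
        ∑' i : ℕ, ENNReal.ofReal (8 * c * ε * 4 ^ i) *
          (if c + i * c < m then 1 else 0) := by
  have one_le : 1 ≤ (1 - ε)⁻¹ := (one_le_inv₀ (by linarith)).2 (by linarith)
  by_cases hm : m ≤ c
  · refine le_trans (ENNReal.ofReal_le_ofReal ?_) le_self_add
    rw [if_pos hm]
    have pow_le : ((1 - ε)⁻¹) ^ m ≤ 2 :=
      (pow_le_pow_right₀ one_le hm).trans (inv_one_sub_pow_le_two hε1 hεc)
    calc ((1 - ε)⁻¹) ^ m - 1 ≤ m * ε * ((1 - ε)⁻¹) ^ m := inv_one_sub_pow_sub_one_le hε1 m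
      _ ≤ m * ε * 2 := by gcongr
      _ = 2 * ε * m := by ring
  · push Not at hm
    set i := (m - c - 1) / c
    have lower : i * c ≤ m - c - 1 := Nat.div_mul_le_self _ _
    have upper : m - c - 1 < (i + 1) * c := by
      rw [mul_comm]
      exact Nat.lt_mul_div_succ _ hc
    have upper_eq : (i + 2) * c = (i + 1) * c + c := by ring
    refine le_trans ?_ (le_trans (ENNReal.le_tsum i) le_add_self)
    rw [if_pos (by omega), mul_one]
    exact ENNReal.ofReal_le_ofReal
      (inv_one_sub_pow_sub_one_le_block hε0 hε1 hεc (by omega))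

/-- Non-asymptotic exponential moment bound for a variable with block-wise geometric tails. -/
lemma lintegral_inv_one_sub_pow_sub_one_le {Ω : Type*} [MeasurableSpace Ω] (P : Measure Ω)
    [IsProbabilityMeasure P] {X : Ω → ℕ} (hX : Measurable X)
    {ε : ℝ} (hε0 : 0 < ε) (hε1 : ε < 1) {c : ℕ} (hc : 1 ≤ c) (hεc : ε * c ≤ 1 / 2)
    {δ : ℝ} (hδ0 : 0 ≤ δ) (hδ : δ ≤ 1 / 8)
    (tail : ∀ i : ℕ, (P {ω | c + i * c < X ω}).toReal ≤ (P {ω | c < X ω}).toReal * δ ^ i) :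
    ∫⁻ ω, ENNReal.ofReal (((1 - ε)⁻¹) ^ X ω - 1) ∂P ≤
      ENNReal.ofReal (ε * (2 * ∫ ω, (if X ω ≤ c then (X ω : ℝ) else 0) ∂P +
        16 * (c * (P {ω | c < X ω}).toReal))) := by
  set p := (P {ω | c < X ω}).toReal
  have p_nonneg : 0 ≤ p := ENNReal.toReal_nonneg
  have trunc_nonneg (ω : Ω) : 0 ≤ (if X ω ≤ c then (X ω : ℝ) else 0) := by
    split_ifs <;> positivity
  have trunc_meas : Measurable fun ω => (if X ω ≤ c then (X ω : ℝ) else 0) :=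
    (measurable_of_countable fun m : ℕ => if m ≤ c then (m : ℝ) else 0).comp hX
  have trunc_integrable : Integrable (fun ω => (if X ω ≤ c then (X ω : ℝ) else 0)) P := by
    refine Integrable.of_bound trunc_meas.aestronglyMeasurable c (.of_forall fun ω => ?_)
    rw [Real.norm_of_nonneg (trunc_nonneg ω)]
    split_ifs with h
    · exact_mod_cast h
    · positivity
  have tail_meas (i : ℕ) : Measurable fun ω => (if c + i * c < X ω then 1 else 0 : ENNReal) :=
    (measurable_of_countable fun m : ℕ => if c + i * c < m then (1 : ENNReal) else 0).comp hX
  have tail_lintegral (i : ℕ) :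
      ∫⁻ ω, (if c + i * c < X ω then 1 else 0 : ENNReal) ∂P = P {ω | c + i * c < X ω} := by
    have hs : MeasurableSet {ω | c + i * c < X ω} := measurableSet_lt measurable_const hX
    rw [← lintegral_indicator_one hs]
    simp only [Set.indicator_apply, Set.mem_ofPred_eq, Pi.one_apply]
  have geom_summable : Summable fun i : ℕ => (4 * δ) ^ i :=
    summable_geometric_of_lt_one (by positivity) (by linarith)
  have geom_le : ∑' i : ℕ, (4 * δ) ^ i ≤ 2 := by
    rw [tsum_geometric_of_lt_one (by positivity) (by linarith)]
    exact inv_le_of_inv_le₀ (by norm_num) (by linarith)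
  have term_le (i : ℕ) : ENNReal.ofReal (8 * c * ε * 4 ^ i) * P {ω | c + i * c < X ω} ≤
      ENNReal.ofReal (8 * c * ε * p * (4 * δ) ^ i) := by
    rw [← ENNReal.ofReal_toReal (measure_ne_top P {ω | c + i * c < X ω}),
      ← ENNReal.ofReal_mul (by positivity)]
    refine ENNReal.ofReal_le_ofReal ?_
    calc 8 * c * ε * 4 ^ i * (P {ω | c + i * c < X ω}).toReal
        ≤ 8 * c * ε * 4 ^ i * (p * δ ^ i) := by
          gcongr
          exact tail i
      _ = 8 * c * ε * p * (4 * δ) ^ i := by rw [mul_pow]; ring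
  calc ∫⁻ ω, ENNReal.ofReal (((1 - ε)⁻¹) ^ X ω - 1) ∂P
      ≤ ∫⁻ ω, (ENNReal.ofReal (2 * ε * (if X ω ≤ c then (X ω : ℝ) else 0)) +
        ∑' i : ℕ, ENNReal.ofReal (8 * c * ε * 4 ^ i) *
          (if c + i * c < X ω then 1 else 0)) ∂P :=
        lintegral_mono fun ω => ofReal_inv_one_sub_pow_sub_one_le hε0 hε1 hc hεc (X ω)
    _ = ENNReal.ofReal (2 * ε * ∫ ω, (if X ω ≤ c then (X ω : ℝ) else 0) ∂P) +
        ∑' i : ℕ, ENNReal.ofReal (8 * c * ε * 4 ^ i) * P {ω | c + i * c < X ω} := by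
      rw [lintegral_add_left (trunc_meas.const_mul _).ennreal_ofReal,
        lintegral_tsum fun i => ((tail_meas i).const_mul _).aemeasurable,
        ← integral_const_mul,
        ofReal_integral_eq_lintegral_ofReal (trunc_integrable.const_mul _)
          (.of_forall fun ω => mul_nonneg (by positivity) (trunc_nonneg ω))]
      congr 1
      refine tsum_congr fun i => ?_
      rw [lintegral_const_mul _ (tail_meas i), tail_lintegral]
    _ ≤ ENNReal.ofReal (2 * ε * ∫ ω, (if X ω ≤ c then (X ω : ℝ) else 0) ∂P) +
        ENNReal.ofReal (8 * c * ε * p * 2) := by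
      gcongr
      refine (ENNReal.tsum_le_tsum term_le).trans ?_
      rw [← ENNReal.ofReal_tsum_of_nonneg (fun i => by positivity)
        (geom_summable.mul_left _), tsum_mul_left]
      exact ENNReal.ofReal_le_ofReal (by gcongr)
    _ = _ := by
      rw [← ENNReal.ofReal_add
        (mul_nonneg (by positivity) (integral_nonneg trunc_nonneg)) (by positivity)]
      congr 1
      ring

/-- Abstract form of the simplified upper bound on exponential moments of trial
durations: under (a) `ε_n C_n → 0`, (b) vanishing truncated means,
(c) `C_n P(Δ_n > C_n) → 0`, (d) block-wise geometric tails with ratio `δ_n`,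
and (e) `δ_n → 0`, one has `E[(1−ε_n)^{−Δ_n}] < ∞` eventually and
`E[(1−ε_n)^{−Δ_n}] = 1 + ε_n · o(1)`. -/
theorem simplified_upper_bound_exponential_moment
    (Ω : ℕ → Type*) [∀ n, MeasurableSpace (Ω n)]
    (P : ∀ n, Measure (Ω n)) [∀ n, IsProbabilityMeasure (P n)]
    (Δ : ∀ n, Ω n → ℕ) (hΔmeas : ∀ n, Measurable (Δ n))
    (ε : ℕ → ℝ) (hε0 : ∀ n, 0 < ε n) (hε1 : ∀ n, ε n < 1)
    (C : ℕ → ℕ) (hC : ∀ n, 1 ≤ C n)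
    (δ : ℕ → ℝ) (hδ0 : ∀ n, 0 ≤ δ n) (hδ1 : ∀ n, δ n < 1)
    (ha : Tendsto (fun n => ε n * C n) atTop (nhds 0))
    (hb : Tendsto (fun n => ∫ ω, (if Δ n ω ≤ C n then (Δ n ω : ℝ) else 0) ∂(P n))
      atTop (nhds 0))
    (hc : Tendsto (fun n => (C n : ℝ) * (P n {ω | C n < Δ n ω}).toReal)
      atTop (nhds 0))
    (hd : ∀ n, ∀ i j : ℕ, j ≤ C n - 1 →
      (P n {ω | C n + i * C n + j < Δ n ω}).toReal
        ≤ (P n {ω | C n < Δ n ω}).toReal * δ n ^ i)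
    (he : Tendsto δ atTop (nhds 0)) :
    (∀ᶠ n in atTop, Integrable (fun ω => ((1 - ε n)⁻¹) ^ (Δ n ω)) (P n)) ∧
    Tendsto (fun n => ((∫ ω, ((1 - ε n)⁻¹) ^ (Δ n ω) ∂(P n)) - 1) / ε n)
      atTop (nhds 0) := by
  have one_le (n : ℕ) : 1 ≤ (1 - ε n)⁻¹ :=
    (one_le_inv₀ (by linarith [hε1 n])).2 (by linarith [hε0 n])
  have excess_nonneg (n : ℕ) (ω : Ω n) : 0 ≤ ((1 - ε n)⁻¹) ^ Δ n ω - 1 :=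
    sub_nonneg.2 (one_le_pow₀ (one_le n))
  have trunc_nonneg (n : ℕ) :
      0 ≤ ∫ ω, (if Δ n ω ≤ C n then (Δ n ω : ℝ) else 0) ∂(P n) :=
    integral_nonneg fun ω => by
      dsimp only
      split_ifs <;> positivity
  have excess_meas (n : ℕ) :
      AEStronglyMeasurable (fun ω => ((1 - ε n)⁻¹) ^ Δ n ω - 1) (P n) :=
    ((measurable_of_countable fun m : ℕ => ((1 - ε n)⁻¹) ^ m - 1).comp
      (hΔmeas n)).aestronglyMeasurable
  have moment_bound : ∀ᶠ n in atTop,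
      ∫⁻ ω, ENNReal.ofReal (((1 - ε n)⁻¹) ^ Δ n ω - 1) ∂(P n) ≤
        ENNReal.ofReal (ε n * (2 * ∫ ω, (if Δ n ω ≤ C n then (Δ n ω : ℝ) else 0) ∂(P n) +
          16 * (C n * (P n {ω | C n < Δ n ω}).toReal))) := by
    filter_upwards [ha.eventually_le_const (by norm_num : (0 : ℝ) < 1 / 2),
      he.eventually_le_const (by norm_num : (0 : ℝ) < 1 / 8)] with n hεC hδ
    exact lintegral_inv_one_sub_pow_sub_one_le (P n) (hΔmeas n) (hε0 n) (hε1 n) (hC n) hεC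
      (hδ0 n) hδ fun i => hd n i 0 (Nat.zero_le _)
  have excess_integrable : ∀ᶠ n in atTop,
      Integrable (fun ω => ((1 - ε n)⁻¹) ^ Δ n ω - 1) (P n) := by
    filter_upwards [moment_bound] with n hn
    refine ⟨excess_meas n, ?_⟩
    rw [hasFiniteIntegral_iff_ofReal (.of_forall (excess_nonneg n))]
    exact hn.trans_lt ENNReal.ofReal_lt_top
  have moment_integrable : ∀ᶠ n in atTop,
      Integrable (fun ω => ((1 - ε n)⁻¹) ^ Δ n ω) (P n) := by
    filter_upwards [excess_integrable] with n hn
    exact (hn.add (integrable_const (1 : ℝ))).congr (.of_forall fun ω => sub_add_cancel _ _)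
  have integral_excess : ∀ᶠ n in atTop,
      (∫ ω, ((1 - ε n)⁻¹) ^ Δ n ω ∂(P n)) - 1 = ∫ ω, (((1 - ε n)⁻¹) ^ Δ n ω - 1) ∂(P n) := by
    filter_upwards [moment_integrable] with n hn
    rw [integral_sub hn (integrable_const 1)]
    simp
  refine ⟨moment_integrable, ?_⟩
  have bound_tendsto : Tendsto
      (fun n => 2 * ∫ ω, (if Δ n ω ≤ C n then (Δ n ω : ℝ) else 0) ∂(P n) +
        16 * (C n * (P n {ω | C n < Δ n ω}).toReal)) atTop (nhds 0) := by
    simpa using (hb.const_mul 2).add (hc.const_mul 16)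
  refine tendsto_of_tendsto_of_tendsto_of_le_of_le' tendsto_const_nhds bound_tendsto ?_ ?_
  · filter_upwards [integral_excess] with n hn
    rw [hn]
    exact div_nonneg (integral_nonneg (excess_nonneg n)) (hε0 n).le
  · filter_upwards [moment_bound, integral_excess] with n hbound hn
    rw [hn, div_le_iff₀' (hε0 n),
      integral_eq_lintegral_of_nonneg_ae (.of_forall (excess_nonneg n)) (excess_meas n)]
    refine ENNReal.toReal_le_of_le_ofReal ?_ hbound
    have := trunc_nonneg n
    have := (hε0 n).le
    positivity
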